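/- If u, v ∈ L^∞_loc(Ω) are nonnegative a.e. in Ω and are both supersolutions of −Δu + |u|^{q−1}u = 0, then the function x ↦ min(u(x), v(x)) is a supersolution of the same equation in Ω. -/

import Mathlib

open MeasureTheory Set Filter

noncomputable section

def laplacian {N : ℕ} (φ : EuclideanSpace ℝ (Fin N) → ℝ) (x : EuclideanSpace ℝ (Fin N)) : ℝ :=
  ∑ i : Fin N, iteratedFDeriv ℝ 2 φ x ![EuclideanSpace.single i 1, EuclideanSpace.single i 1]

def IsTestFun {N : ℕ} (Ω : Set (EuclideanSpace ℝ (Fin N))) (φ : EuclideanSpace ℝ (Fin N) → ℝ) : Prop :=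
  ContDiff ℝ (⊤ : ℕ∞) φ ∧ HasCompactSupport φ ∧ tsupport φ ⊆ Ω

def MemLqLoc {N : ℕ} (q : ℝ) (Ω : Set (EuclideanSpace ℝ (Fin N)))
    (u : EuclideanSpace ℝ (Fin N) → ℝ) : Prop :=
  AEStronglyMeasurable u (volume.restrict Ω) ∧
  ∀ K : Set (EuclideanSpace ℝ (Fin N)), K ⊆ Ω → IsCompact K →
    IntegrableOn (fun x => |u x| ^ q) K volume

def MemLinftyLoc {N : ℕ} (Ω : Set (EuclideanSpace ℝ (Fin N)))
    (u : EuclideanSpace ℝ (Fin N) → ℝ) : Prop :=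
  AEStronglyMeasurable u (volume.restrict Ω) ∧
  ∀ K : Set (EuclideanSpace ℝ (Fin N)), K ⊆ Ω → IsCompact K →
    ∃ M : ℝ, ∀ᵐ x ∂(volume.restrict K), |u x| ≤ M

def IsSubsolution {N : ℕ} (q : ℝ) (Ω : Set (EuclideanSpace ℝ (Fin N)))
    (u : EuclideanSpace ℝ (Fin N) → ℝ) : Prop :=
  MemLqLoc q Ω u ∧
  ∀ φ : EuclideanSpace ℝ (Fin N) → ℝ, IsTestFun Ω φ → (∀ x, 0 ≤ φ x) →
    (∫ x in Ω, (-(u x) * laplacian φ x + |u x| ^ (q - 1) * u x * φ x)) ≤ 0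

def IsSupersolution {N : ℕ} (q : ℝ) (Ω : Set (EuclideanSpace ℝ (Fin N)))
    (u : EuclideanSpace ℝ (Fin N) → ℝ) : Prop :=
  MemLqLoc q Ω u ∧
  ∀ φ : EuclideanSpace ℝ (Fin N) → ℝ, IsTestFun Ω φ → (∀ x, 0 ≤ φ x) →
    0 ≤ (∫ x in Ω, (-(u x) * laplacian φ x + |u x| ^ (q - 1) * u x * φ x))

def IsSolution {N : ℕ} (q : ℝ) (Ω : Set (EuclideanSpace ℝ (Fin N)))
    (u : EuclideanSpace ℝ (Fin N) → ℝ) : Prop :=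
  MemLqLoc q Ω u ∧
  ∀ φ : EuclideanSpace ℝ (Fin N) → ℝ, IsTestFun Ω φ →
    (∫ x in Ω, (-(u x) * laplacian φ x + |u x| ^ (q - 1) * u x * φ x)) = 0


lemma laplacian_eq_sum_fderiv_fderiv {N : ℕ} {φ : EuclideanSpace ℝ (Fin N) → ℝ}
    (hφ : ContDiff ℝ 2 φ) (x : EuclideanSpace ℝ (Fin N)) :
    laplacian φ x = ∑ i : Fin N, fderiv ℝ
      (fun y => fderiv ℝ φ y (EuclideanSpace.single i 1)) x (EuclideanSpace.single i 1) := by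
  unfold laplacian
  refine Finset.sum_congr rfl fun i _ => ?_
  have h : DifferentiableAt ℝ (fderiv ℝ φ) x :=
    ((hφ.fderiv_right (m := 1) (by norm_num)).differentiable (by norm_num)) x
  rw [iteratedFDeriv_two_apply, fderiv_clm_apply h (differentiableAt_const _)]
  simp

lemma contDiff_fderiv_apply_const {E : Type*} [NormedAddCommGroup E] [NormedSpace ℝ E]
    {φ : E → ℝ} {m n : WithTop ℕ∞} (hφ : ContDiff ℝ n φ) (hmn : m + 1 ≤ n) (e : E) :
    ContDiff ℝ m (fun y => fderiv ℝ φ y e) :=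
  (hφ.fderiv_right hmn).clm_apply contDiff_const

lemma continuous_laplacian {N : ℕ} {φ : EuclideanSpace ℝ (Fin N) → ℝ} (hφ : ContDiff ℝ 2 φ) :
    Continuous (laplacian φ) := by
  unfold laplacian
  refine continuous_finsetSum _ fun i _ => ?_
  exact (hφ.continuous_iteratedFDeriv le_rfl).eval_const _

lemma support_laplacian_subset {N : ℕ} (φ : EuclideanSpace ℝ (Fin N) → ℝ) :
    Function.support (laplacian φ) ⊆ tsupport φ := by
  intro x hx
  by_contra h
  apply hx
  have : iteratedFDeriv ℝ 2 φ x = 0 :=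
    Function.notMem_support.1 fun h' => h (support_iteratedFDeriv_subset 2 h')
  simp [laplacian, this]

lemma hasCompactSupport_laplacian {N : ℕ} {φ : EuclideanSpace ℝ (Fin N) → ℝ}
    (hφ : HasCompactSupport φ) : HasCompactSupport (laplacian φ) :=
  hφ.mono' (support_laplacian_subset φ)

lemma laplacian_comp_const_sub {N : ℕ} {φ : EuclideanSpace ℝ (Fin N) → ℝ}
    (hφ : ContDiff ℝ 2 φ) (x t : EuclideanSpace ℝ (Fin N)) :
    laplacian (fun y => φ (x - y)) t = laplacian φ (x - t) := by
  have key : ∀ {ψ : EuclideanSpace ℝ (Fin N) → ℝ}, ContDiff ℝ 1 ψ → ∀ s e,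
      fderiv ℝ (fun y => ψ (x - y)) s e = - fderiv ℝ ψ (x - s) e := by
    intro ψ hψ s e
    have h := ((hψ.differentiable (by norm_num)) (x - s)).hasFDerivAt.comp s
      ((hasFDerivAt_id s).const_sub x)
    have := h.fderiv
    simp only [Function.comp_def] at this
    rw [this]; simp
  have hφ' : ContDiff ℝ 2 (fun y => φ (x - y)) := hφ.comp (contDiff_const.sub contDiff_id)
  rw [laplacian_eq_sum_fderiv_fderiv hφ, laplacian_eq_sum_fderiv_fderiv hφ']
  refine Finset.sum_congr rfl fun i _ => ?_
  have h1 : (fun y => fderiv ℝ (fun y => φ (x - y)) y (EuclideanSpace.single i 1)) =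
      fun y => - (fun z => fderiv ℝ φ z (EuclideanSpace.single i 1)) (x - y) := by
    ext y
    exact key (hφ.of_le (by norm_num)) y _
  have h2 : ContDiff ℝ 1 (fun z => fderiv ℝ φ z (EuclideanSpace.single i (1 : ℝ))) :=
    contDiff_fderiv_apply_const hφ (by norm_num) _
  rw [h1, fderiv_fun_neg, neg_apply, key h2, neg_neg]

lemma fderiv_convolution_apply {E : Type*} [NormedAddCommGroup E] [NormedSpace ℝ E]
    [FiniteDimensional ℝ E] [MeasurableSpace E] [BorelSpace E] {μ : Measure E} [SFinite μ]
    [μ.IsAddLeftInvariant]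
    {a ρ : E → ℝ} (ha : LocallyIntegrable a μ)
    (hρ : ContDiff ℝ 1 ρ) (hc : HasCompactSupport ρ) (x e : E) :
    fderiv ℝ (MeasureTheory.convolution a ρ (ContinuousLinearMap.mul ℝ ℝ) μ) x e =
      MeasureTheory.convolution a (fun y => fderiv ℝ ρ y e) (ContinuousLinearMap.mul ℝ ℝ) μ x := by
  have h := (hc.hasFDerivAt_convolution_right (ContinuousLinearMap.mul ℝ ℝ) ha hρ x).fderiv
  rw [h, convolution_precompR_apply _ ha (hc.fderiv ℝ) (hρ.continuous_fderiv (by norm_num))]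

lemma laplacian_convolution {N : ℕ} {a ρ : EuclideanSpace ℝ (Fin N) → ℝ}
    (ha : LocallyIntegrable a volume) (hρ : ContDiff ℝ 2 ρ) (hc : HasCompactSupport ρ)
    (x : EuclideanSpace ℝ (Fin N)) :
    laplacian (MeasureTheory.convolution a ρ (ContinuousLinearMap.mul ℝ ℝ) volume) x =
      ∫ t, a t * laplacian ρ (x - t) := by
  have hC : ContDiff ℝ (2 : ℕ∞) (MeasureTheory.convolution a ρ
      (ContinuousLinearMap.mul ℝ ℝ) volume) :=
    hc.contDiff_convolution_right _ ha (by exact_mod_cast hρ)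
  rw [laplacian_eq_sum_fderiv_fderiv (by exact_mod_cast hC)]
  simp_rw [laplacian_eq_sum_fderiv_fderiv hρ, Finset.mul_sum]
  have h2 (i : Fin N) : ContDiff ℝ 1 (fun z => fderiv ℝ ρ z (EuclideanSpace.single i (1 : ℝ))) :=
    contDiff_fderiv_apply_const hρ (by norm_num) _
  have h2c (i : Fin N) : HasCompactSupport
      (fun z => fderiv ℝ ρ z (EuclideanSpace.single i (1 : ℝ))) := hc.fderiv_apply ℝ _
  rw [integral_finsetSum]
  · refine Finset.sum_congr rfl fun i _ => ?_
    have h1 : (fun y => fderiv ℝ (MeasureTheory.convolution a ρ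
        (ContinuousLinearMap.mul ℝ ℝ) volume) y (EuclideanSpace.single i 1)) =
        MeasureTheory.convolution a (fun y => fderiv ℝ ρ y (EuclideanSpace.single i 1))
          (ContinuousLinearMap.mul ℝ ℝ) volume := by
      ext y
      exact fderiv_convolution_apply ha (hρ.of_le (by norm_num)) hc y _
    rw [h1, fderiv_convolution_apply ha (h2 i) (h2c i), convolution_mul]
  · intro i _
    exact ((h2c i).fderiv_apply ℝ (EuclideanSpace.single i (1 : ℝ))).convolutionExists_right
      (ContinuousLinearMap.mul ℝ ℝ) ha
      (contDiff_fderiv_apply_const (h2 i) (m := 0) (by norm_num) _).continuous x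

lemma integral_mul_laplacian_comm {N : ℕ} {w φ : EuclideanSpace ℝ (Fin N) → ℝ}
    (hw : ContDiff ℝ 2 w) (hφ : ContDiff ℝ 2 φ) (hc : HasCompactSupport φ) :
    ∫ x, w x * laplacian φ x = ∫ x, laplacian w x * φ x := by
  simp_rw [laplacian_eq_sum_fderiv_fderiv hφ, laplacian_eq_sum_fderiv_fderiv hw,
    Finset.mul_sum, Finset.sum_mul]
  have hwi (i : Fin N) : ContDiff ℝ 1 (fun z => fderiv ℝ w z (EuclideanSpace.single i (1 : ℝ))) :=
    contDiff_fderiv_apply_const hw (by norm_num) _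
  have hφi (i : Fin N) : ContDiff ℝ 1 (fun z => fderiv ℝ φ z (EuclideanSpace.single i (1 : ℝ))) :=
    contDiff_fderiv_apply_const hφ (by norm_num) _
  have hci (i : Fin N) : HasCompactSupport
      (fun z => fderiv ℝ φ z (EuclideanSpace.single i (1 : ℝ))) := hc.fderiv_apply ℝ _
  have hwii (i : Fin N) := (contDiff_fderiv_apply_const (hwi i) (m := 0) (by norm_num)
    (EuclideanSpace.single i (1 : ℝ))).continuous
  have hφii (i : Fin N) := (contDiff_fderiv_apply_const (hφi i) (m := 0) (by norm_num)
    (EuclideanSpace.single i (1 : ℝ))).continuous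
  have hcii (i : Fin N) := (hci i).fderiv_apply ℝ (EuclideanSpace.single i (1 : ℝ))
  have I1 (i : Fin N) := (hw.continuous.mul (hφii i)).integrable_of_hasCompactSupport
    (μ := volume) ((hcii i).mul_left (f := w))
  have I2 (i : Fin N) := ((hwi i).continuous.mul (hφi i).continuous).integrable_of_hasCompactSupport
    (μ := volume) ((hci i).mul_left)
  have I3 (i : Fin N) := ((hwii i).mul hφ.continuous).integrable_of_hasCompactSupport
    (μ := volume) (hc.mul_left)
  have I4 (i : Fin N) := (hw.continuous.mul (hφi i).continuous).integrable_of_hasCompactSupport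
    (μ := volume) ((hci i).mul_left)
  have I5 (i : Fin N) := ((hwi i).continuous.mul hφ.continuous).integrable_of_hasCompactSupport
    (μ := volume) (hc.mul_left)
  rw [integral_finsetSum Finset.univ (fun i _ => by exact I1 i),
    integral_finsetSum Finset.univ (fun i _ => by exact I3 i)]
  refine Finset.sum_congr rfl fun i _ => ?_
  rw [integral_mul_fderiv_eq_neg_fderiv_mul_of_integrable (I2 i) (I1 i) (I4 i)
      (fun x _ => hw.differentiable (by norm_num) x)
      (fun x _ => (hφi i).differentiable (by norm_num) x),
    integral_mul_fderiv_eq_neg_fderiv_mul_of_integrable (I3 i) (I2 i) (I5 i)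
      (fun x _ => (hwi i).differentiable (by norm_num) x)
      (fun x _ => hφ.differentiable (by norm_num) x), neg_neg]

/-- The concave function `(s, t) ↦ (s + t) / 2 - h (s - t) / 2`, with `h` convex and `1`-Lipschitz,
preserves upper bounds on the Laplacian. -/
lemma laplacian_half_add_sub_comp_le {N : ℕ} {U V : EuclideanSpace ℝ (Fin N) → ℝ} {h : ℝ → ℝ}
    (hU : ContDiff ℝ 2 U) (hV : ContDiff ℝ 2 V) (hh : ContDiff ℝ 2 h)
    (h1 : ∀ t, |deriv h t| ≤ 1) (h2 : ∀ t, 0 ≤ deriv (deriv h) t)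
    {x : EuclideanSpace ℝ (Fin N)} {F G : ℝ} (hF : laplacian U x ≤ F) (hG : laplacian V x ≤ G) :
    laplacian (fun y => (U y + V y) / 2 - h (U y - V y) / 2) x ≤
      (1 - deriv h (U x - V x)) / 2 * F + (1 + deriv h (U x - V x)) / 2 * G := by
  have hW : ContDiff ℝ 2 (fun y => (U y + V y) / 2 - h (U y - V y) / 2) :=
    ((hU.add hV).div_const 2).sub ((hh.comp (hU.sub hV)).div_const 2)
  have hh' : ContDiff ℝ 1 (deriv h) := by
    have := (contDiff_succ_iff_deriv (n := 1) (f := h) (𝕜 := ℝ)).1 (by norm_num; exact hh)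
    exact this.2.2
  have dU : Differentiable ℝ U := hU.differentiable (by norm_num)
  have dV : Differentiable ℝ V := hV.differentiable (by norm_num)
  have dh : Differentiable ℝ h := hh.differentiable (by norm_num)
  have dh' : Differentiable ℝ (deriv h) := hh'.differentiable (by norm_num)
  have first (e y : EuclideanSpace ℝ (Fin N)) :
      fderiv ℝ (fun y => (U y + V y) / 2 - h (U y - V y) / 2) y e =
        (fderiv ℝ U y e + fderiv ℝ V y e) / 2 -
          deriv h (U y - V y) * (fderiv ℝ U y e - fderiv ℝ V y e) / 2 := by
    have a1 := ((dU y).hasFDerivAt.add (dV y).hasFDerivAt).mul_const (2⁻¹ : ℝ)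
    have a2 := ((dh (U y - V y)).hasDerivAt.comp_hasFDerivAt y
      ((dU y).hasFDerivAt.sub (dV y).hasFDerivAt)).mul_const (2⁻¹ : ℝ)
    have := (a1.sub a2).fderiv
    simp only [div_eq_mul_inv]
    refine (congrArg (fun L : EuclideanSpace ℝ (Fin N) →L[ℝ] ℝ => L e) this).trans ?_
    simp
    ring
  have second (e : EuclideanSpace ℝ (Fin N)) :
      fderiv ℝ (fun y => fderiv ℝ (fun y => (U y + V y) / 2 - h (U y - V y) / 2) y e) x e ≤
        (1 - deriv h (U x - V x)) / 2 * fderiv ℝ (fun y => fderiv ℝ U y e) x e +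
        (1 + deriv h (U x - V x)) / 2 * fderiv ℝ (fun y => fderiv ℝ V y e) x e := by
    simp_rw [first]
    have dUe := ((contDiff_fderiv_apply_const hU (m := 1) (by norm_num) e).differentiable
      (by norm_num) x).hasFDerivAt
    have dVe := ((contDiff_fderiv_apply_const hV (m := 1) (by norm_num) e).differentiable
      (by norm_num) x).hasFDerivAt
    have a1 := (dUe.add dVe).mul_const (2⁻¹ : ℝ)
    have a2 := (((dh' (U x - V x)).hasDerivAt.comp_hasFDerivAt x
      ((dU x).hasFDerivAt.sub (dV x).hasFDerivAt)).mul (dUe.sub dVe)).mul_const (2⁻¹ : ℝ)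
    have := (a1.sub a2).fderiv
    simp only [div_eq_mul_inv]
    refine (congrArg (fun L : EuclideanSpace ℝ (Fin N) →L[ℝ] ℝ => L e) this).le.trans ?_
    have := mul_nonneg (h2 (U x - V x)) (sq_nonneg (fderiv ℝ U x e - fderiv ℝ V x e))
    simp
    nlinarith
  rw [laplacian_eq_sum_fderiv_fderiv hW]
  calc _ ≤ ∑ i, _ := Finset.sum_le_sum fun i _ => second (EuclideanSpace.single i 1)
    _ = (1 - deriv h (U x - V x)) / 2 * laplacian U x +
        (1 + deriv h (U x - V x)) / 2 * laplacian V x := by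
      rw [laplacian_eq_sum_fderiv_fderiv hU, laplacian_eq_sum_fderiv_fderiv hV,
        Finset.sum_add_distrib, Finset.mul_sum, Finset.mul_sum]
    _ ≤ _ := by
      have := abs_le.1 (h1 (U x - V x))
      gcongr <;> linarith

lemma locallyIntegrable_of_ae_abs_le {E : Type*} [TopologicalSpace E] [LocallyCompactSpace E]
    [MeasurableSpace E] {μ : Measure E} [IsLocallyFiniteMeasure μ] {a : E → ℝ} {M : ℝ}
    (ha : AEStronglyMeasurable a μ) (hM : ∀ᵐ x ∂μ, |a x| ≤ M) : LocallyIntegrable a μ :=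
  (locallyIntegrable_const M).mono ha <| hM.mono fun x hx => by
    simpa using hx.trans (le_abs_self M)

lemma integrable_mul_of_ae_abs_le {E : Type*} [TopologicalSpace E]
    [MeasurableSpace E] [BorelSpace E] {μ : Measure E} [IsFiniteMeasureOnCompacts μ]
    {a φ : E → ℝ} {M : ℝ}
    (ha : AEStronglyMeasurable a μ) (hM : ∀ᵐ x ∂μ, |a x| ≤ M)
    (hφ : Continuous φ) (hc : HasCompactSupport φ) : Integrable (fun x => a x * φ x) μ :=
  (hφ.integrable_of_hasCompactSupport hc).bdd_mul ha hM

lemma abs_convolution_le {E : Type*} [NormedAddCommGroup E] [NormedSpace ℝ E]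
    [MeasurableSpace E] [BorelSpace E] {μ : Measure E} [μ.IsAddLeftInvariant] [μ.IsNegInvariant]
    {a ρ : E → ℝ} {M : ℝ} (hM : ∀ᵐ x ∂μ, |a x| ≤ M) (hρ0 : ∀ x, 0 ≤ ρ x)
    (hρ : Integrable ρ μ) (hρ1 : ∫ x, ρ x ∂μ = 1) (x : E) :
    |MeasureTheory.convolution a ρ (ContinuousLinearMap.mul ℝ ℝ) μ x| ≤ M := by
  rw [convolution_mul]
  calc |∫ t, a t * ρ (x - t) ∂μ| ≤ ∫ t, M * ρ (x - t) ∂μ := by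
        rw [← Real.norm_eq_abs]
        refine norm_integral_le_of_norm_le ((hρ.comp_sub_left x).const_mul M) ?_
        filter_upwards [hM] with t ht
        rw [Real.norm_eq_abs, abs_mul, abs_of_nonneg (hρ0 _)]
        exact mul_le_mul_of_nonneg_right ht (hρ0 _)
    _ = M := by rw [integral_const_mul, integral_sub_left_eq_self ρ μ x, hρ1, mul_one]

lemma laplacian_convolution_le {N : ℕ} {a f : EuclideanSpace ℝ (Fin N) → ℝ}
    {S : Set (EuclideanSpace ℝ (Fin N))} (ha : LocallyIntegrable a volume)
    (haf : ∀ ψ : EuclideanSpace ℝ (Fin N) → ℝ, IsTestFun S ψ → (∀ x, 0 ≤ ψ x) →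
      ∫ x, a x * laplacian ψ x ≤ ∫ x, f x * ψ x)
    (b : ContDiffBump (0 : EuclideanSpace ℝ (Fin N))) {x : EuclideanSpace ℝ (Fin N)}
    (hx : Metric.closedBall x b.rOut ⊆ S) :
    laplacian (MeasureTheory.convolution a (b.normed volume)
        (ContinuousLinearMap.mul ℝ ℝ) volume) x ≤
      MeasureTheory.convolution f (b.normed volume) (ContinuousLinearMap.mul ℝ ℝ) volume x := by
  have hb : ContDiff ℝ 2 (b.normed volume) := by exact_mod_cast b.contDiff_normed (n := 2)
  rw [laplacian_convolution ha hb b.hasCompactSupport_normed, convolution_mul]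
  simp_rw [← laplacian_comp_const_sub hb]
  have hsub : tsupport (fun t => b.normed volume (x - t)) ⊆ Metric.closedBall x b.rOut := by
    refine closure_minimal (fun t ht => ?_) Metric.isClosed_closedBall
    have : x - t ∈ Function.support (b.normed volume) := ht
    rw [b.support_normed_eq, mem_ball_zero_iff] at this
    rw [mem_closedBall_iff_norm, norm_sub_rev]
    exact this.le
  refine haf _ ⟨?_, ?_, hsub.trans hx⟩ fun t => b.nonneg_normed _
  · exact b.contDiff_normed.comp (contDiff_const.sub contDiff_id)
  · exact (isCompact_closedBall x b.rOut).of_isClosed_subset (isClosed_tsupport _) hsub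

lemma exists_contDiffBump_seq {N : ℕ} {r : ℝ} (hr : 0 < r) :
    ∃ b : ℕ → ContDiffBump (0 : EuclideanSpace ℝ (Fin N)), (∀ n, (b n).rOut ≤ r) ∧
      ∀ a : EuclideanSpace ℝ (Fin N) → ℝ, LocallyIntegrable a volume → ∀ᵐ x,
        Tendsto (fun n => MeasureTheory.convolution a ((b n).normed volume)
          (ContinuousLinearMap.mul ℝ ℝ) volume x) atTop (nhds (a x)) := by
  let b : ℕ → ContDiffBump (0 : EuclideanSpace ℝ (Fin N)) := fun n =>
    ⟨r / (n + 1) / 2, r / (n + 1), by positivity, half_lt_self (by positivity)⟩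
  refine ⟨b, fun n => div_le_self hr.le (by simp), fun a ha => ?_⟩
  have hlim : Tendsto (fun n => (b n).rOut) atTop (nhds 0) := by
    have := (tendsto_one_div_add_atTop_nhds_zero_nat (𝕜 := ℝ)).const_mul r
    simpa [b, div_eq_mul_inv] using this
  have hK : ∀ᶠ n in atTop, (b n).rOut ≤ 2 * (b n).rIn :=
    Eventually.of_forall fun n => by simp only [b]; linarith
  filter_upwards [ContDiffBump.ae_convolution_tendsto_right_of_locallyIntegrable
    (μ := volume) hlim hK ha] with x hx
  refine hx.congr fun n => ?_
  rw [convolution_lsmul_swap, convolution_mul]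
  simp_rw [smul_eq_mul, mul_comm]

lemma abs_convex_weights_le {s x y M : ℝ} (hs : |s| ≤ 1) (hx : |x| ≤ M) (hy : |y| ≤ M) :
    |(1 - s) / 2 * x + (1 + s) / 2 * y| ≤ M := by
  rw [abs_le] at *
  constructor <;> nlinarith

lemma abs_half_add_sub_half_le {x y z M : ℝ} (hx : |x| ≤ M) (hy : |y| ≤ M)
    (hz : |z| ≤ |x - y| + 1) : |(x + y) / 2 - z / 2| ≤ 2 * M + 1 := by
  rw [abs_le] at *
  rcases abs_cases (x - y) with h | h <;> constructor <;> linarith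

/-- A regularised Kato inequality for bounded functions. -/
lemma integral_half_add_sub_comp_mul_laplacian_le {N : ℕ}
    {a b f g φ : EuclideanSpace ℝ (Fin N) → ℝ} {h : ℝ → ℝ} {M r : ℝ} (hr : 0 < r)
    (ha : AEStronglyMeasurable a volume) (hb : AEStronglyMeasurable b volume)
    (hf : AEStronglyMeasurable f volume) (hg : AEStronglyMeasurable g volume)
    (haM : ∀ᵐ x, |a x| ≤ M) (hbM : ∀ᵐ x, |b x| ≤ M)
    (hfM : ∀ᵐ x, |f x| ≤ M) (hgM : ∀ᵐ x, |g x| ≤ M)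
    (hφ : ContDiff ℝ 2 φ) (hc : HasCompactSupport φ) (hφ0 : ∀ x, 0 ≤ φ x)
    (haf : ∀ ψ : EuclideanSpace ℝ (Fin N) → ℝ, IsTestFun (Metric.cthickening r (tsupport φ)) ψ →
      (∀ x, 0 ≤ ψ x) → ∫ x, a x * laplacian ψ x ≤ ∫ x, f x * ψ x)
    (hbg : ∀ ψ : EuclideanSpace ℝ (Fin N) → ℝ, IsTestFun (Metric.cthickening r (tsupport φ)) ψ →
      (∀ x, 0 ≤ ψ x) → ∫ x, b x * laplacian ψ x ≤ ∫ x, g x * ψ x)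
    (hh : ContDiff ℝ 2 h) (h0 : ∀ t, |h t| ≤ |t| + 1) (h1 : ∀ t, |deriv h t| ≤ 1)
    (h2 : ∀ t, 0 ≤ deriv (deriv h) t) :
    ∫ x, ((a x + b x) / 2 - h (a x - b x) / 2) * laplacian φ x ≤
      ∫ x, ((1 - deriv h (a x - b x)) / 2 * f x + (1 + deriv h (a x - b x)) / 2 * g x) * φ x := by
  obtain ⟨β, hβr, hβ⟩ := exists_contDiffBump_seq (N := N) hr
  have la := locallyIntegrable_of_ae_abs_le ha haM
  have lb := locallyIntegrable_of_ae_abs_le hb hbM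
  have lf := locallyIntegrable_of_ae_abs_le hf hfM
  have lg := locallyIntegrable_of_ae_abs_le hg hgM
  let C (w : EuclideanSpace ℝ (Fin N) → ℝ) (n : ℕ) : EuclideanSpace ℝ (Fin N) → ℝ :=
    MeasureTheory.convolution w ((β n).normed volume) (ContinuousLinearMap.mul ℝ ℝ) volume
  have Csmooth {w} (hw : LocallyIntegrable w volume) (n : ℕ) : ContDiff ℝ 2 (C w n) := by
    exact_mod_cast (β n).hasCompactSupport_normed.contDiff_convolution_right (n := 2) _ hw
      (β n).contDiff_normed
  have Cle {w} (hw : ∀ᵐ x, |w x| ≤ M) (n : ℕ) (x) : |C w n x| ≤ M :=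
    abs_convolution_le (a := w) hw (fun y => (β n).nonneg_normed y) (β n).integrable_normed
      (β n).integral_normed x
  have hh' : Continuous (deriv h) := hh.continuous_deriv (by norm_num)
  have step (n : ℕ) :
      ∫ x, ((C a n x + C b n x) / 2 - h (C a n x - C b n x) / 2) * laplacian φ x ≤
      ∫ x, ((1 - deriv h (C a n x - C b n x)) / 2 * C f n x +
        (1 + deriv h (C a n x - C b n x)) / 2 * C g n x) * φ x := by
    have hW : ContDiff ℝ 2 (fun x => (C a n x + C b n x) / 2 - h (C a n x - C b n x) / 2) :=
      (((Csmooth la n).add (Csmooth lb n)).div_const 2).sub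
        ((hh.comp ((Csmooth la n).sub (Csmooth lb n))).div_const 2)
    rw [integral_mul_laplacian_comm hW hφ hc]
    have ca := (Csmooth la n).continuous
    have cb := (Csmooth lb n).continuous
    have cf := (Csmooth lf n).continuous
    have cg := (Csmooth lg n).continuous
    refine integral_mono
      (((continuous_laplacian hW).mul hφ.continuous).integrable_of_hasCompactSupport hc.mul_left)
      (Continuous.integrable_of_hasCompactSupport (by fun_prop) hc.mul_left) fun x => ?_
    by_cases hx : x ∈ tsupport φ
    · have hball : Metric.closedBall x (β n).rOut ⊆ Metric.cthickening r (tsupport φ) :=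
        (Metric.closedBall_subset_closedBall (hβr n)).trans
          (Metric.closedBall_subset_cthickening hx r)
      exact mul_le_mul_of_nonneg_right
        (laplacian_half_add_sub_comp_le (Csmooth la n) (Csmooth lb n) hh h1 h2
          (laplacian_convolution_le la haf (β n) hball)
          (laplacian_convolution_le lb hbg (β n) hball)) (hφ0 x)
    · simp [image_eq_zero_of_notMem_tsupport hx]
  have cΔ := continuous_laplacian hφ
  have L1 : Tendsto (fun n => ∫ x, ((C a n x + C b n x) / 2 - h (C a n x - C b n x) / 2) *
      laplacian φ x) atTop
      (nhds (∫ x, ((a x + b x) / 2 - h (a x - b x) / 2) * laplacian φ x)) := by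
    refine tendsto_integral_of_dominated_convergence (fun x => (2 * M + 1) * |laplacian φ x|)
      (fun n => ?_)
      ((cΔ.integrable_of_hasCompactSupport (hasCompactSupport_laplacian hc)).abs.const_mul _)
      (fun n => Eventually.of_forall fun x => ?_) ?_
    · have ca := (Csmooth la n).continuous
      have cb := (Csmooth lb n).continuous
      have ch := hh.continuous
      exact Continuous.aestronglyMeasurable (by fun_prop)
    · rw [Real.norm_eq_abs, abs_mul]
      exact mul_le_mul_of_nonneg_right
        (abs_half_add_sub_half_le (Cle haM n x) (Cle hbM n x) (h0 _)) (abs_nonneg _)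
    · filter_upwards [hβ a la, hβ b lb] with x hxa hxb
      exact (((hxa.add hxb).div_const 2).sub
        (((hh.continuous.tendsto _).comp (hxa.sub hxb)).div_const 2)).mul_const _
  have L2 : Tendsto (fun n => ∫ x, ((1 - deriv h (C a n x - C b n x)) / 2 * C f n x +
        (1 + deriv h (C a n x - C b n x)) / 2 * C g n x) * φ x) atTop
      (nhds (∫ x, ((1 - deriv h (a x - b x)) / 2 * f x +
        (1 + deriv h (a x - b x)) / 2 * g x) * φ x)) := by
    refine tendsto_integral_of_dominated_convergence (fun x => M * |φ x|)
      (fun n => ?_)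
      ((hφ.continuous.integrable_of_hasCompactSupport hc).abs.const_mul _)
      (fun n => Eventually.of_forall fun x => ?_) ?_
    · have ca := (Csmooth la n).continuous
      have cb := (Csmooth lb n).continuous
      have cf := (Csmooth lf n).continuous
      have cg := (Csmooth lg n).continuous
      have cφ := hφ.continuous
      exact Continuous.aestronglyMeasurable (by fun_prop)
    · rw [Real.norm_eq_abs, abs_mul]
      exact mul_le_mul_of_nonneg_right
        (abs_convex_weights_le (h1 _) (Cle hfM n x) (Cle hgM n x)) (abs_nonneg _)
    · filter_upwards [hβ a la, hβ b lb, hβ f lf, hβ g lg] with x hxa hxb hxf hxg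
      have := (hh'.tendsto _).comp (hxa.sub hxb)
      exact (((((tendsto_const_nhds (x := (1 : ℝ))).sub this).div_const 2).mul hxf).add
        ((((tendsto_const_nhds (x := (1 : ℝ))).add this).div_const 2).mul hxg)).mul_const _
  exact le_of_tendsto_of_tendsto' L1 L2 step

lemma hasDerivAt_sqrt_sq_add_sq {δ : ℝ} (hδ : 0 < δ) (t : ℝ) :
    HasDerivAt (fun t => √(t ^ 2 + δ ^ 2)) (t / √(t ^ 2 + δ ^ 2)) t := by
  have h : HasDerivAt (fun t : ℝ => t ^ 2 + δ ^ 2) (2 * t) t := by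
    simpa using (hasDerivAt_pow 2 t).add_const (δ ^ 2)
  convert h.sqrt (by positivity) using 1
  field_simp

lemma deriv_sqrt_sq_add_sq {δ : ℝ} (hδ : 0 < δ) :
    deriv (fun t => √(t ^ 2 + δ ^ 2)) = fun t => t / √(t ^ 2 + δ ^ 2) :=
  funext fun t => (hasDerivAt_sqrt_sq_add_sq hδ t).deriv

lemma deriv_deriv_sqrt_sq_add_sq_nonneg {δ : ℝ} (hδ : 0 < δ) (t : ℝ) :
    0 ≤ deriv (deriv (fun t => √(t ^ 2 + δ ^ 2))) t := by
  have hs : 0 < √(t ^ 2 + δ ^ 2) := Real.sqrt_pos.2 (by positivity)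
  rw [deriv_sqrt_sq_add_sq hδ,
    ((hasDerivAt_id' t).fun_div (hasDerivAt_sqrt_sq_add_sq hδ t) hs.ne').deriv]
  refine div_nonneg ?_ (sq_nonneg _)
  have h : t * (t / √(t ^ 2 + δ ^ 2)) ≤ √(t ^ 2 + δ ^ 2) := by
    rw [← mul_div_assoc, div_le_iff₀ hs, Real.mul_self_sqrt (by positivity)]
    nlinarith
  linarith

lemma abs_div_sqrt_sq_add_sq_le_one (δ t : ℝ) : |t / √(t ^ 2 + δ ^ 2)| ≤ 1 := by
  rw [abs_div, abs_of_nonneg (Real.sqrt_nonneg _)]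
  refine div_le_one_of_le₀ (Real.abs_le_sqrt ?_) (Real.sqrt_nonneg _)
  nlinarith [sq_nonneg δ]

lemma abs_sqrt_sq_add_sq_le {δ : ℝ} (hδ : 0 < δ) (hδ1 : δ ≤ 1) (t : ℝ) :
    |√(t ^ 2 + δ ^ 2)| ≤ |t| + 1 := by
  rw [abs_of_nonneg (Real.sqrt_nonneg _)]
  refine Real.sqrt_le_iff.2 ⟨by positivity, ?_⟩
  nlinarith [sq_abs t, abs_nonneg t]

lemma half_add_sub_half_abs_sub (s t : ℝ) : (s + t) / 2 - |s - t| / 2 = min s t := by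
  rcases le_total s t with h | h
  · rw [abs_of_nonpos (sub_nonpos.2 h), min_eq_left h]
    ring
  · rw [abs_of_nonneg (sub_nonneg.2 h), min_eq_right h]
    ring

/-- Kato's inequality for the minimum of two bounded functions. -/
lemma integral_min_mul_laplacian_le {N : ℕ}
    {a b f g φ : EuclideanSpace ℝ (Fin N) → ℝ} {M r : ℝ} (hr : 0 < r)
    (ha : AEStronglyMeasurable a volume) (hb : AEStronglyMeasurable b volume)
    (hf : AEStronglyMeasurable f volume) (hg : AEStronglyMeasurable g volume)
    (haM : ∀ᵐ x, |a x| ≤ M) (hbM : ∀ᵐ x, |b x| ≤ M)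
    (hfM : ∀ᵐ x, |f x| ≤ M) (hgM : ∀ᵐ x, |g x| ≤ M)
    (hφ : ContDiff ℝ 2 φ) (hc : HasCompactSupport φ) (hφ0 : ∀ x, 0 ≤ φ x)
    (haf : ∀ ψ : EuclideanSpace ℝ (Fin N) → ℝ, IsTestFun (Metric.cthickening r (tsupport φ)) ψ →
      (∀ x, 0 ≤ ψ x) → ∫ x, a x * laplacian ψ x ≤ ∫ x, f x * ψ x)
    (hbg : ∀ ψ : EuclideanSpace ℝ (Fin N) → ℝ, IsTestFun (Metric.cthickening r (tsupport φ)) ψ →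
      (∀ x, 0 ≤ ψ x) → ∫ x, b x * laplacian ψ x ≤ ∫ x, g x * ψ x) :
    ∫ x, min (a x) (b x) * laplacian φ x ≤
      ∫ x, ((1 - (a x - b x) / |a x - b x|) / 2 * f x +
        (1 + (a x - b x) / |a x - b x|) / 2 * g x) * φ x := by
  let δ (n : ℕ) : ℝ := 1 / ((n : ℝ) + 1)
  have hδ (n : ℕ) : 0 < δ n := Nat.one_div_pos_of_nat
  have hδ1 (n : ℕ) : δ n ≤ 1 := div_le_one_of_le₀ (by simp) (by positivity)
  have hlim (t : ℝ) : Tendsto (fun n => √(t ^ 2 + δ n ^ 2)) atTop (nhds |t|) := by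
    have : Tendsto (fun n => √(t ^ 2 + δ n ^ 2)) atTop (nhds √(t ^ 2 + 0 ^ 2)) :=
      ((tendsto_one_div_add_atTop_nhds_zero_nat.pow 2).const_add (t ^ 2)).sqrt
    simpa [Real.sqrt_sq_eq_abs] using this
  have hlim' (t : ℝ) : Tendsto (fun n => t / √(t ^ 2 + δ n ^ 2)) atTop (nhds (t / |t|)) := by
    rcases eq_or_ne t 0 with rfl | ht
    · simp
    · exact tendsto_const_nhds.div (hlim t) (abs_ne_zero.2 ht)
  have step (n : ℕ) := integral_half_add_sub_comp_mul_laplacian_le (h := fun t => √(t ^ 2 + δ n ^ 2))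
    hr ha hb hf hg haM hbM hfM hgM hφ hc hφ0 haf hbg
    (ContDiff.sqrt (by fun_prop) fun t => by have := hδ n; positivity)
    (abs_sqrt_sq_add_sq_le (hδ n) (hδ1 n))
    (fun t => by
      rw [deriv_sqrt_sq_add_sq (hδ n)]
      exact abs_div_sqrt_sq_add_sq_le_one _ _)
    (deriv_deriv_sqrt_sq_add_sq_nonneg (hδ n))
  simp_rw [deriv_sqrt_sq_add_sq (hδ _)] at step
  simp_rw [← half_add_sub_half_abs_sub]
  have cΔ := continuous_laplacian hφ
  have aam := ha.aemeasurable
  have abm := hb.aemeasurable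
  have afm := hf.aemeasurable
  have agm := hg.aemeasurable
  have mφ := hφ.continuous.measurable
  refine le_of_tendsto_of_tendsto' (b := atTop) ?_ ?_ step
  · refine tendsto_integral_of_dominated_convergence (fun x => (2 * M + 1) * |laplacian φ x|)
      (fun n => ?_)
      ((cΔ.integrable_of_hasCompactSupport (hasCompactSupport_laplacian hc)).abs.const_mul _)
      (fun n => ?_) (Eventually.of_forall fun x => ?_)
    · have mΔ := cΔ.measurable
      exact AEMeasurable.aestronglyMeasurable (by fun_prop)
    · filter_upwards [haM, hbM] with x hxa hxb
      rw [Real.norm_eq_abs, abs_mul]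
      exact mul_le_mul_of_nonneg_right (abs_half_add_sub_half_le hxa hxb
        (abs_sqrt_sq_add_sq_le (hδ n) (hδ1 n) _)) (abs_nonneg _)
    · exact (((hlim _).div_const 2).const_sub _).mul_const _
  · refine tendsto_integral_of_dominated_convergence (fun x => M * |φ x|)
      (fun n => ?_)
      ((hφ.continuous.integrable_of_hasCompactSupport hc).abs.const_mul _)
      (fun n => ?_) (Eventually.of_forall fun x => ?_)
    · exact AEMeasurable.aestronglyMeasurable (by fun_prop)
    · filter_upwards [hfM, hgM] with x hxf hxg
      rw [Real.norm_eq_abs, abs_mul]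
      exact mul_le_mul_of_nonneg_right (abs_convex_weights_le
        (abs_div_sqrt_sq_add_sq_le_one _ _) hxf hxg) (abs_nonneg _)
    · exact (((((hlim' _).const_sub 1).div_const 2).mul_const _).add
        ((((hlim' _).const_add 1).div_const 2).mul_const _)).mul_const _

lemma sign_weights_apply_eq_apply_min (F : ℝ → ℝ) (s t : ℝ) :
    (1 - (s - t) / |s - t|) / 2 * F s + (1 + (s - t) / |s - t|) / 2 * F t = F (min s t) := by
  rcases lt_trichotomy s t with h | rfl | h
  · rw [abs_of_neg (sub_neg.2 h), div_neg, div_self (sub_neg.2 h).ne, min_eq_left h.le]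
    ring
  · simp
    ring
  · rw [abs_of_pos (sub_pos.2 h), div_self (sub_pos.2 h).ne', min_eq_right h.le]
    ring

lemma abs_rpow_sub_one_mul_le {q t M : ℝ} (hq : 1 ≤ q) (ht : |t| ≤ M) :
    |(|t| ^ (q - 1) * t)| ≤ M ^ (q - 1) * M := by
  rw [abs_mul, abs_of_nonneg (Real.rpow_nonneg (abs_nonneg t) _)]
  have hM := (abs_nonneg t).trans ht
  exact mul_le_mul (Real.rpow_le_rpow (abs_nonneg t) ht (by linarith)) ht (abs_nonneg t)
    (Real.rpow_nonneg hM _)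

lemma setIntegral_eq_sub_integral_indicator {N : ℕ} {q M : ℝ} (hq : 1 ≤ q)
    {Ω K : Set (EuclideanSpace ℝ (Fin N))} (hKΩ : K ⊆ Ω) {w ψ : EuclideanSpace ℝ (Fin N) → ℝ}
    (hw : AEStronglyMeasurable (K.indicator w) volume) (hM : ∀ᵐ x, |K.indicator w x| ≤ M)
    (hψ : ContDiff ℝ 2 ψ) (hc : HasCompactSupport ψ) (hψK : tsupport ψ ⊆ K) :
    ∫ x in Ω, (-(w x) * laplacian ψ x + |w x| ^ (q - 1) * w x * ψ x) =
      (∫ x, |K.indicator w x| ^ (q - 1) * K.indicator w x * ψ x) -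
        ∫ x, K.indicator w x * laplacian ψ x := by
  have hout (x) (hx : x ∉ K) : laplacian ψ x = 0 ∧ ψ x = 0 :=
    ⟨Function.notMem_support.1 fun h => hx (hψK (support_laplacian_subset ψ h)),
      image_eq_zero_of_notMem_tsupport fun h => hx (hψK h)⟩
  have mw := hw.aemeasurable
  rw [← integral_sub, setIntegral_eq_integral_of_forall_compl_eq_zero]
  · refine integral_congr_ae (Eventually.of_forall fun x => ?_)
    by_cases hx : x ∈ K
    · simp only [indicator_of_mem hx]
      ring
    · simp [hout x hx]
  · intro x hx
    simp [hout x fun h => hx (hKΩ h)]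
  · exact integrable_mul_of_ae_abs_le (AEMeasurable.aestronglyMeasurable (by fun_prop))
      (hM.mono fun x hx => abs_rpow_sub_one_mul_le hq hx) hψ.continuous hc
  · exact integrable_mul_of_ae_abs_le hw hM (continuous_laplacian hψ)
      (hasCompactSupport_laplacian hc)

lemma memLqLoc_min {N : ℕ} {q : ℝ} {Ω : Set (EuclideanSpace ℝ (Fin N))}
    {u v : EuclideanSpace ℝ (Fin N) → ℝ} (hu : MemLqLoc q Ω u) (hv : MemLqLoc q Ω v) :
    MemLqLoc q Ω (fun x => min (u x) (v x)) := by
  have hm := hu.1.inf hv.1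
  refine ⟨hm, fun K hKΩ hK => ?_⟩
  refine Integrable.mono' ((hu.2 K hKΩ hK).add (hv.2 K hKΩ hK)) ?_
    (Eventually.of_forall fun x => ?_)
  · have := (hm.mono_measure (Measure.restrict_mono hKΩ le_rfl)).aemeasurable
    have h : AEMeasurable (fun x => min (u x) (v x)) (volume.restrict K) := this
    exact AEMeasurable.aestronglyMeasurable (by fun_prop)
  · have h1 := Real.rpow_nonneg (abs_nonneg (u x)) q
    have h2 := Real.rpow_nonneg (abs_nonneg (v x)) q
    simp only [Real.norm_eq_abs, abs_of_nonneg (Real.rpow_nonneg (abs_nonneg _) _), Pi.add_apply]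
    rcases min_choice (u x) (v x) with h | h <;> rw [h] <;> linarith

lemma MemLinftyLoc.exists_ae_abs_indicator_le {N : ℕ} {Ω K : Set (EuclideanSpace ℝ (Fin N))}
    {u : EuclideanSpace ℝ (Fin N) → ℝ} (hu : MemLinftyLoc Ω u) (hKΩ : K ⊆ Ω) (hK : IsCompact K) :
    AEStronglyMeasurable (K.indicator u) volume ∧ ∃ M, ∀ᵐ x, |K.indicator u x| ≤ M := by
  refine ⟨(aestronglyMeasurable_indicator_iff hK.measurableSet).2
    (hu.1.mono_measure (Measure.restrict_mono hKΩ le_rfl)), ?_⟩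
  obtain ⟨M, hM⟩ := hu.2 K hKΩ hK
  refine ⟨max M 0, ?_⟩
  filter_upwards [(ae_restrict_iff' hK.measurableSet).1 hM] with x hx
  by_cases hxK : x ∈ K
  · rw [indicator_of_mem hxK]
    exact (hx hxK).trans (le_max_left _ _)
  · simp [hxK]

/-- The minimum of two locally bounded supersolutions is a supersolution. -/
lemma isSupersolution_min {N : ℕ} {q : ℝ} (hq : 1 ≤ q)
    {Ω : Set (EuclideanSpace ℝ (Fin N))} (hΩ : IsOpen Ω)
    {u v : EuclideanSpace ℝ (Fin N) → ℝ}
    (huloc : MemLinftyLoc Ω u) (hvloc : MemLinftyLoc Ω v)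
    (hu : IsSupersolution q Ω u) (hv : IsSupersolution q Ω v) :
    IsSupersolution q Ω (fun x => min (u x) (v x)) := by
  refine ⟨memLqLoc_min hu.1 hv.1, fun φ hφ hφ0 => ?_⟩
  obtain ⟨hφs, hc, hφΩ⟩ := hφ
  obtain ⟨r, hr, hKΩ⟩ := hc.isCompact.exists_cthickening_subset_open hΩ hφΩ
  set K := Metric.cthickening r (tsupport φ)
  have hK : IsCompact K := hc.isCompact.cthickening
  have two {ψ : EuclideanSpace ℝ (Fin N) → ℝ} (h : ContDiff ℝ (⊤ : ℕ∞) ψ) : ContDiff ℝ 2 ψ :=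
    h.of_le (WithTop.coe_le_coe.2 le_top)
  obtain ⟨hum, A, hA⟩ := huloc.exists_ae_abs_indicator_le hKΩ hK
  obtain ⟨hvm, B, hB⟩ := hvloc.exists_ae_abs_indicator_le hKΩ hK
  have ind_min : (K.indicator fun x => min (u x) (v x)) =
      fun x => min (K.indicator u x) (K.indicator v x) := by
    ext x
    by_cases hx : x ∈ K <;> simp [hx]
  set a := K.indicator u
  set b := K.indicator v
  let F (t : ℝ) : ℝ := |t| ^ (q - 1) * t
  let M := max (max A B) (max (A ^ (q - 1) * A) (B ^ (q - 1) * B))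
  have amb : AEMeasurable a volume := hum.aemeasurable
  have bmb : AEMeasurable b volume := hvm.aemeasurable
  have bound : ∀ᵐ x, |min (a x) (b x)| ≤ max A B := by
    filter_upwards [hA, hB] with x hxa hxb
    rcases min_choice (a x) (b x) with h | h <;> rw [h]
    exacts [hxa.trans (le_max_left _ _), hxb.trans (le_max_right _ _)]
  rw [setIntegral_eq_sub_integral_indicator (M := max A B) hq hKΩ
    (by rw [ind_min]; exact hum.inf hvm) (by rw [ind_min]; exact bound) (two hφs) hc
    (Metric.self_subset_cthickening _), ind_min, sub_nonneg]
  refine (integral_min_mul_laplacian_le (M := M) (f := fun x => F (a x)) (g := fun x => F (b x))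
    hr hum hvm (AEMeasurable.aestronglyMeasurable (by fun_prop))
    (AEMeasurable.aestronglyMeasurable (by fun_prop)) ?_ ?_ ?_ ?_ (two hφs) hc hφ0 ?_ ?_).trans ?_
  · exact hA.mono fun x hx => hx.trans ((le_max_left _ _).trans (le_max_left _ _))
  · exact hB.mono fun x hx => hx.trans ((le_max_right _ _).trans (le_max_left _ _))
  · exact hA.mono fun x hx => (abs_rpow_sub_one_mul_le hq hx).trans
      ((le_max_left _ _).trans (le_max_right _ _))
  · exact hB.mono fun x hx => (abs_rpow_sub_one_mul_le hq hx).trans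
      ((le_max_right _ _).trans (le_max_right _ _))
  · intro ψ hψ hψ0
    have := hu.2 ψ ⟨hψ.1, hψ.2.1, hψ.2.2.trans hKΩ⟩ hψ0
    rwa [setIntegral_eq_sub_integral_indicator hq hKΩ hum hA (two hψ.1) hψ.2.1 hψ.2.2,
      sub_nonneg] at this
  · intro ψ hψ hψ0
    have := hv.2 ψ ⟨hψ.1, hψ.2.1, hψ.2.2.trans hKΩ⟩ hψ0
    rwa [setIntegral_eq_sub_integral_indicator hq hKΩ hvm hB (two hψ.1) hψ.2.1 hψ.2.2,
      sub_nonneg] at this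
  · simp_rw [sign_weights_apply_eq_apply_min F]
    exact le_rfl

theorem stmt5 {N : ℕ} (hN : 2 ≤ N) (q : ℝ) (hq : ((N : ℝ) + 1) / ((N : ℝ) - 1) ≤ q)
    (Ω : Set (EuclideanSpace ℝ (Fin N))) (hΩ : IsOpen Ω) (hΩne : Ω.Nonempty)
    (u v : EuclideanSpace ℝ (Fin N) → ℝ)
    (huloc : MemLinftyLoc Ω u) (hvloc : MemLinftyLoc Ω v)
    (hupos : ∀ᵐ x ∂(volume.restrict Ω), 0 ≤ u x)
    (hvpos : ∀ᵐ x ∂(volume.restrict Ω), 0 ≤ v x)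
    (husup : IsSupersolution q Ω u) (hvsup : IsSupersolution q Ω v) :
    IsSupersolution q Ω (fun x => min (u x) (v x)) := by
  refine isSupersolution_min ?_ hΩ huloc hvloc husup hvsup
  have h : (2 : ℝ) ≤ N := by exact_mod_cast hN
  refine le_trans ?_ hq
  rw [one_le_div (by linarith)]
  linarith
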